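/- arXiv:0909.5573 — 2 statements merged into one kernel-verified Lean document; each statement's English description precedes it below -/
import Mathlib

section
/- Let G be a finite connected non-bipartite (q+1)-regular graph with q ≥ 2, and let φ be an eigenfunction of the normalized Laplacian L f(v) = (1/(q+1)) Σ_{w∼v} f(w) with eigenvalue μ ≠ 1. Then the average of the lift of φ over the spherical arc A_n(a) of radius n in the universal covering tree tends to 0 as n → ∞, for every directed edge a of G. -/
open scoped Classical

/-- The spherical arc `A_r(a)` in a tree, based at the directed edge `a = (w', w)`:
`A_0 = {w'}` and `A_{r+1} = S_{r+1}(w') ∩ S_r(w)`. -/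
def sphericalArc {V : Type*} (T : SimpleGraph V) (w' w : V) : ℕ → Set V
  | 0 => {w'}
  | (r + 1) => {x | T.dist w' x = r + 1 ∧ T.dist w x = r}

namespace SimpleGraph.IsTree

variable {V : Type*} {T : SimpleGraph V}

/-- A vertex of a tree has at most one neighbour that is closer to a given vertex. -/
theorem eq_of_adj_of_dist_add_one (hT : T.IsTree) {w y z x : V} (hy : T.Adj w y)
    (hz : T.Adj w z) (hyx : T.dist w x = T.dist y x + 1) (hzx : T.dist w x = T.dist z x + 1) :
    y = z := by
  obtain ⟨p, hp⟩ := hT.connected.exists_walk_length_eq_dist y x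
  obtain ⟨r, hr⟩ := hT.connected.exists_walk_length_eq_dist z x
  have hp' : (Walk.cons hy p).IsPath := Walk.isPath_of_length_eq_dist _ (by simp [hp, hyx])
  have hr' : (Walk.cons hz r).IsPath := Walk.isPath_of_length_eq_dist _ (by simp [hr, hzx])
  simpa using congrArg Walk.snd ((hT.existsUnique_path w x).unique hp' hr')

theorem sphericalArc_one (hT : T.IsTree) {w' w : V} (h : T.Adj w' w) :
    sphericalArc T w' w 1 = {w} := by
  ext x
  simp only [sphericalArc, Set.mem_ofPred_eq, Set.mem_singleton_iff]
  constructor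
  · exact fun hx => (hT.connected.dist_eq_zero_iff.1 hx.2).symm
  · rintro rfl
    simpa using h

theorem sphericalArc_add_two (hT : T.IsTree) {w' w : V} (h : T.Adj w' w) (n : ℕ) :
    sphericalArc T w' w (n + 2) =
      ⋃ y ∈ T.neighborSet w \ {w'}, sphericalArc T w y (n + 1) := by
  ext x
  simp only [sphericalArc, Set.mem_ofPred_eq, Set.mem_iUnion, Set.mem_sdiff, mem_neighborSet,
    Set.mem_singleton_iff, exists_prop]
  constructor
  · rintro ⟨hw', hw⟩
    obtain ⟨p, hp⟩ := hT.connected.exists_walk_length_eq_dist w x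
    cases p with
    | nil => simp at hw
    | @cons _ y _ hy p =>
      have hle := dist_le p
      have htri := hT.connected.dist_triangle (u := w) (v := y) (w := x)
      rw [dist_eq_one_iff_adj.2 hy] at htri
      rw [Walk.length_cons] at hp
      refine ⟨y, ⟨hy, ?_⟩, hw, by omega⟩
      rintro rfl
      omega
  · rintro ⟨y, ⟨hy, hne⟩, hw, hyx⟩
    refine ⟨?_, hw⟩
    have := hT.dist_eq_dist_add_one_of_adj x h
    rw [dist_comm (u := x) (v := w'), dist_comm (u := x) (v := w)] at this
    rcases this with h1 | h1
    · omega
    · exact absurd (hT.eq_of_adj_of_dist_add_one hy h.symm (by omega) h1) hne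

theorem pairwiseDisjoint_sphericalArc (hT : T.IsTree) (w' w : V) (n : ℕ) :
    (T.neighborSet w \ {w'}).PairwiseDisjoint fun y => sphericalArc T w y (n + 1) := by
  intro y hy z hz hne
  refine Set.disjoint_left.2 fun x hxy hxz => hne ?_
  exact hT.eq_of_adj_of_dist_add_one hy.1 hz.1 (by rw [hxy.1, hxy.2]) (by rw [hxz.1, hxz.2])

theorem finite_sphericalArc [T.LocallyFinite] (hT : T.IsTree) {w' w : V} (h : T.Adj w' w)
    (n : ℕ) : (sphericalArc T w' w (n + 1)).Finite := by
  induction n generalizing w' w with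
  | zero => simp [hT.sphericalArc_one h]
  | succ n ih =>
    rw [hT.sphericalArc_add_two h]
    exact ((Set.toFinite _).sdiff).biUnion fun y hy => ih hy.1

theorem finsum_sphericalArc_add_two [T.LocallyFinite] (hT : T.IsTree) {w' w : V}
    (h : T.Adj w' w) (f : V → ℝ) (n : ℕ) :
    ∑ᶠ x ∈ sphericalArc T w' w (n + 2), f x =
      ∑ y ∈ (T.neighborFinset w).erase w', ∑ᶠ x ∈ sphericalArc T w y (n + 1), f x := by
  rw [hT.sphericalArc_add_two h, finsum_mem_biUnion (hT.pairwiseDisjoint_sphericalArc w' w n)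
    ((Set.toFinite _).sdiff) fun y hy => hT.finite_sphericalArc hy.1 n,
    ← finsum_mem_coe_finset]
  simp

theorem ncard_sphericalArc [T.LocallyFinite] (hT : T.IsTree) {q : ℕ}
    (hreg : T.IsRegularOfDegree (q + 1)) {w' w : V} (h : T.Adj w' w) (n : ℕ) :
    ((sphericalArc T w' w (n + 1)).ncard : ℝ) = (q : ℝ) ^ n := by
  have key : ∑ᶠ x ∈ sphericalArc T w' w (n + 1), (1 : ℝ) = (q : ℝ) ^ n := by
    induction n generalizing w' w with
    | zero => simp [hT.sphericalArc_one h]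
    | succ n ih =>
      rw [hT.finsum_sphericalArc_add_two h,
        Finset.sum_congr rfl fun y hy =>
          ih ((T.mem_neighborFinset w y).1 (Finset.mem_of_mem_erase hy)),
        Finset.sum_const, Finset.card_erase_of_mem (by simpa using h.symm),
        card_neighborFinset_eq_degree, hreg.degree_eq]
      simp [pow_succ, mul_comm]
  rw [← key, finsum_mem_eq_finite_toFinset_sum _ (hT.finite_sphericalArc h n),
    Set.ncard_eq_toFinset_card _ (hT.finite_sphericalArc h n)]
  simp

theorem finsum_sphericalArc_recurrence [T.LocallyFinite] (hT : T.IsTree) {q : ℕ}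
    (hreg : T.IsRegularOfDegree (q + 1)) {f : V → ℝ} {c : ℝ}
    (hf : ∀ v, ∑ y ∈ T.neighborFinset v, f y = c * f v) {w' w : V} (h : T.Adj w' w) (n : ℕ) :
    ∑ᶠ x ∈ sphericalArc T w' w (n + 3), f x =
      c * ∑ᶠ x ∈ sphericalArc T w' w (n + 2), f x -
        q * ∑ᶠ x ∈ sphericalArc T w' w (n + 1), f x := by
  have hsum : ∀ {a b : V}, T.Adj a b →
      ∑ᶠ x ∈ sphericalArc T a b 2, f x = c * f b - f a := by
    intro a b hab
    rw [hT.finsum_sphericalArc_add_two hab, ← hf b,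
      ← Finset.add_sum_erase _ _ ((T.mem_neighborFinset b a).2 hab.symm), add_sub_cancel_left]
    refine Finset.sum_congr rfl fun y hy => ?_
    rw [hT.sphericalArc_one ((T.mem_neighborFinset b y).1 (Finset.mem_of_mem_erase hy)),
      finsum_mem_singleton]
  induction n generalizing w' w with
  | zero =>
    rw [hT.finsum_sphericalArc_add_two h, hT.finsum_sphericalArc_add_two h,
      hT.sphericalArc_one h, finsum_mem_singleton, Finset.mul_sum]
    have hadj : ∀ y ∈ (T.neighborFinset w).erase w', T.Adj w y := fun y hy =>
      (T.mem_neighborFinset w y).1 (Finset.mem_of_mem_erase hy)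
    rw [Finset.sum_congr rfl fun y hy => hsum (hadj y hy), Finset.sum_sub_distrib,
      Finset.sum_const, Finset.card_erase_of_mem (by simpa using h.symm),
      card_neighborFinset_eq_degree, hreg.degree_eq, nsmul_eq_mul, Nat.add_sub_cancel]
    congr 1
    refine Finset.sum_congr rfl fun y hy => ?_
    rw [hT.sphericalArc_one (hadj y hy), finsum_mem_singleton]
  | succ n ih =>
    rw [hT.finsum_sphericalArc_add_two h, hT.finsum_sphericalArc_add_two h,
      hT.finsum_sphericalArc_add_two h, Finset.mul_sum, Finset.mul_sum,
      ← Finset.sum_sub_distrib]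
    exact Finset.sum_congr rfl fun y hy =>
      ih ((T.mem_neighborFinset w y).1 (Finset.mem_of_mem_erase hy))

end SimpleGraph.IsTree

/-- The eigenvalues other than `1` of the normalized adjacency operator of a finite connected
non-bipartite regular graph have absolute value less than `1`. -/
theorem SimpleGraph.abs_eigenvalue_lt_one {V : Type*} [Fintype V] {G : SimpleGraph V}
    [G.LocallyFinite] (hconn : G.Connected) (hbip : ¬ G.Colorable 2) {d : ℕ}
    (hreg : G.IsRegularOfDegree d) (hd : 0 < d) {μ : ℝ} (hμ : μ ≠ 1) {φ : V → ℝ} (hφ : φ ≠ 0)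
    (heig : ∀ v, ∑ w ∈ G.neighborFinset v, φ w = d * μ * φ v) : |μ| < 1 := by
  have := hconn.nonempty
  obtain ⟨v₀, hv₀⟩ := Finite.exists_max fun v => |φ v|
  obtain ⟨v₁, hv₁⟩ := Function.ne_iff.1 hφ
  have hpos : 0 < |φ v₀| := (abs_pos.2 hv₁).trans_le (hv₀ v₁)
  have hd' : (0 : ℝ) < d := by exact_mod_cast hd
  have hcard : ∀ v, (G.neighborFinset v).card = d := fun v => by
    rw [card_neighborFinset_eq_degree, hreg.degree_eq]
  have hle : |μ| ≤ 1 := by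
    have h1 : |∑ w ∈ G.neighborFinset v₀, φ w| ≤ d * |φ v₀| := by
      refine (Finset.abs_sum_le_sum_abs _ _).trans
        ((Finset.sum_le_card_nsmul _ _ _ fun w _ => hv₀ w).trans ?_)
      rw [hcard, nsmul_eq_mul]
    rw [heig, abs_mul, abs_mul, abs_of_pos hd', mul_assoc] at h1
    nlinarith [le_of_mul_le_mul_left h1 hd']
  refine hle.lt_of_ne fun habs => hbip ?_
  have hneg : μ = -1 := (eq_or_eq_neg_of_abs_eq habs).resolve_left hμ
  have hstep : ∀ v w, |φ v| = |φ v₀| → G.Adj v w → φ w = -φ v := by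
    intro v w hv hvw
    have hnonneg : ∀ y ∈ G.neighborFinset v, 0 ≤ φ v * (φ y + φ v) := by
      intro y _
      have h1 : |φ v * φ y| ≤ φ v * φ v := by
        rw [abs_mul, ← abs_mul_abs_self (φ v)]
        exact mul_le_mul_of_nonneg_left (hv ▸ hv₀ y) (abs_nonneg _)
      linarith [(abs_le.1 h1).1]
    have hsum : ∑ y ∈ G.neighborFinset v, φ v * (φ y + φ v) = 0 := by
      rw [← Finset.mul_sum, Finset.sum_add_distrib, heig, Finset.sum_const, hcard, hneg,
        nsmul_eq_mul]
      ring
    have h0 := (Finset.sum_eq_zero_iff_of_nonneg hnonneg).1 hsum w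
      ((G.mem_neighborFinset v w).2 hvw)
    have hne : φ v ≠ 0 := abs_pos.1 (hv ▸ hpos)
    linarith [(mul_eq_zero.1 h0).resolve_left hne]
  have hwalk : ∀ {v w}, G.Walk v w → |φ w| = |φ v₀| → |φ v| = |φ v₀| := by
    intro v w p hw
    induction p with
    | nil => exact hw
    | cons h p ih => rw [hstep _ _ (ih hw) h.symm, abs_neg, ih hw]
  have hall : ∀ v, |φ v| = |φ v₀| := fun v => (hconn v v₀).elim fun p => hwalk p rfl
  have hc : G.Coloring Prop := Coloring.mk (fun v => 0 < φ v) fun {v w} hvw heq => by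
    have h1 := hstep v w (hall v) hvw
    have h2 : φ v ≠ 0 := abs_pos.1 (hall v ▸ hpos)
    rw [h1] at heq
    rcases lt_or_gt_of_ne h2 with h3 | h3
    · exact absurd (heq.mpr (by linarith)) (by linarith)
    · exact absurd (heq.mp h3) (by linarith)
  simpa using hc.colorable

theorem norm_lt_one_of_quadratic_root {b c : ℝ} (hc0 : 0 < c) (hc1 : c < 1)
    (hb : |b| < 1 + c) {z : ℂ} (hz : z * z - b * z + c = 0) : ‖z‖ < 1 := by
  have hre := congrArg Complex.re hz
  have him := congrArg Complex.im hz
  simp at hre him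
  obtain ⟨hb1, hb2⟩ := abs_lt.1 hb
  rw [← sq_lt_one_iff₀ (norm_nonneg z), Complex.sq_norm, Complex.normSq_apply]
  have him' : z.im * (2 * z.re - b) = 0 := by linarith
  rcases mul_eq_zero.1 him' with h | h
  · rw [h] at hre ⊢
    have : |z.re| < 1 := by
      by_contra! hcon
      rcases le_abs.1 hcon with h1 | h1 <;> nlinarith
    nlinarith [abs_lt.1 this]
  · nlinarith

/-- Solutions of `x (n + 2) = b * x (n + 1) - c * x n` tend to zero when both roots of the
characteristic polynomial lie in the open unit disc. -/
theorem tendsto_zero_of_linear_recurrence {b c : ℝ} (hc0 : 0 < c) (hc1 : c < 1)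
    (hb : |b| < 1 + c) {x : ℕ → ℝ} (hx : ∀ n, x (n + 2) = b * x (n + 1) - c * x n) :
    Filter.Tendsto x Filter.atTop (nhds 0) := by
  obtain ⟨s, hs⟩ := IsAlgClosed.exists_pow_nat_eq ((b : ℂ) ^ 2 - 4 * c) (n := 2) two_pos
  set α : ℂ := (b + s) / 2 with hα
  set β : ℂ := (b - s) / 2 with hβ
  have hsum : α + β = b := by rw [hα, hβ]; ring
  have hprod : α * β = c := by rw [hα, hβ]; linear_combination (-1 / 4 : ℂ) * hs
  have hαn : ‖α‖ < 1 := norm_lt_one_of_quadratic_root hc0 hc1 hb (by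
    rw [← hsum, ← hprod]; ring)
  have hβn : ‖β‖ < 1 := norm_lt_one_of_quadratic_root hc0 hc1 hb (by
    rw [← hsum, ← hprod]; ring)
  have hgeom : ∀ n, (x (n + 1) : ℂ) = α * x n + β ^ n * (x 1 - α * x 0) := by
    intro n
    induction n with
    | zero => simp
    | succ n ih =>
      rw [hx]
      push_cast
      rw [← hsum, ← hprod, pow_succ]
      linear_combination β * ih
  set ρ := max ‖α‖ ‖β‖ with hρ
  have hρ1 : ρ < 1 := max_lt hαn hβn
  have hρ0 : 0 < ρ := by
    refine lt_max_of_lt_left (norm_pos_iff.2 fun h => ?_)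
    rw [h, zero_mul] at hprod
    exact hc0.ne (by exact_mod_cast hprod)
  set K := max |x 0| (‖(x 1 : ℂ) - α * x 0‖ / ρ) with hK
  have hK1 : ‖(x 1 : ℂ) - α * x 0‖ ≤ K * ρ := (div_le_iff₀ hρ0).1 (le_max_right _ _)
  have hbound : ∀ n, ‖x n‖ ≤ K * ((n + 1) * ρ ^ n) := by
    intro n
    induction n with
    | zero => simp [hK]
    | succ n ih =>
      calc ‖x (n + 1)‖ = ‖(x (n + 1) : ℂ)‖ := (Complex.norm_real _).symm
        _ ≤ ‖α‖ * ‖x n‖ + ‖β‖ ^ n * ‖(x 1 : ℂ) - α * x 0‖ := by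
          rw [hgeom]
          refine (norm_add_le _ _).trans_eq ?_
          rw [norm_mul, norm_mul, norm_pow, Complex.norm_real]
        _ ≤ ρ * (K * ((n + 1) * ρ ^ n)) + ρ ^ n * (K * ρ) := by
          gcongr
          · exact le_max_left _ _
          · exact le_max_right _ _
        _ = K * (((n + 1 : ℕ) + 1) * ρ ^ (n + 1)) := by push_cast; ring
  refine squeeze_zero_norm hbound ?_
  have h1 := (tendsto_self_mul_const_pow_of_lt_one hρ0.le hρ1).add
    (tendsto_pow_atTop_nhds_zero_of_lt_one hρ0.le hρ1)
  simpa [add_mul] using h1.const_mul K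

/-- Let `G` be a finite connected non-bipartite `(q+1)`-regular graph, `T` its universal
covering tree with covering projection `π`, and `φ` an eigenfunction of the normalized
Laplacian with eigenvalue `μ ≠ 1`. Then the average of the lift `φ ∘ π` over the
spherical arc of radius `n` based at any directed edge of the tree tends to `0`. -/
theorem stmt_4 (q : ℕ) (hq : 2 ≤ q) {VG VT : Type*} [Fintype VG]
    (G : SimpleGraph VG) (hGconn : G.Connected) (hGnonbip : ¬ G.Colorable 2)
    (hGreg : G.IsRegularOfDegree (q + 1))
    (T : SimpleGraph VT) (hT : T.IsTree) (π : T →g G)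
    (hcov : ∀ v : VT, Set.BijOn π (T.neighborSet v) (G.neighborSet (π v)))
    (μ : ℝ) (hμ : μ ≠ 1) (φ : VG → ℝ) (hφ : φ ≠ 0)
    (heig : ∀ v : VG, ∑ w ∈ G.neighborFinset v, φ w = ((q : ℝ) + 1) * μ * φ v) :
    ∀ w' w : VT, T.Adj w' w →
      Filter.Tendsto
        (fun n : ℕ =>
          (∑ᶠ x ∈ sphericalArc T w' w n, φ (π x)) / ((sphericalArc T w' w n).ncard : ℝ))
        Filter.atTop (nhds 0) := by
  have hq0 : (0 : ℝ) < q := by positivity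
  have habs : |μ| < 1 :=
    G.abs_eigenvalue_lt_one hGconn hGnonbip hGreg q.succ_pos hμ hφ (by
      intro v
      push_cast
      convert heig v)
  have hfin : ∀ v, (T.neighborSet v).Finite := fun v =>
    Set.Finite.of_finite_image ((Set.toFinite _).subset (hcov v).image_eq.subset) (hcov v).injOn
  let _ : T.LocallyFinite := fun v => (hfin v).fintype
  have himage : ∀ v, (T.neighborFinset v).image π = G.neighborFinset (π v) := fun v => by
    rw [← Finset.coe_inj, Finset.coe_image, SimpleGraph.coe_neighborFinset,
      SimpleGraph.coe_neighborFinset, (hcov v).image_eq]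
  have hinj : ∀ v, Set.InjOn π (T.neighborFinset v) := fun v => by
    rw [SimpleGraph.coe_neighborFinset]
    exact (hcov v).injOn
  have hTreg : T.IsRegularOfDegree (q + 1) := fun v => by
    rw [← SimpleGraph.card_neighborFinset_eq_degree, ← Finset.card_image_of_injOn (hinj v),
      himage, SimpleGraph.card_neighborFinset_eq_degree]
    exact hGreg.degree_eq _
  have hTeig : ∀ v, ∑ y ∈ T.neighborFinset v, φ (π y) = ((q : ℝ) + 1) * μ * φ (π v) :=
    fun v => by rw [← heig, ← himage, Finset.sum_image (hinj v)]
  intro w' w h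
  rw [← Filter.tendsto_add_atTop_iff_nat 1]
  refine tendsto_zero_of_linear_recurrence (b := (1 + 1 / q) * μ) (c := 1 / q) (by positivity)
    ?_ ?_ fun n => ?_
  · rw [div_lt_one hq0]
    exact_mod_cast hq
  · rw [abs_mul, abs_of_pos (by positivity)]
    exact mul_lt_of_lt_one_right (by positivity) habs
  · rw [hT.ncard_sphericalArc hTreg h, hT.ncard_sphericalArc hTreg h,
      hT.ncard_sphericalArc hTreg h, hT.finsum_sphericalArc_recurrence hTreg hTeig h]
    field_simp
    ring
end

section
/- Let G be a finite simple connected (q+1)-regular graph, q ≥ 2, and f : E → ℝ a function on its edges. Then there exist constants C > 0 and β ∈ {1/q} ∪ [q^{-1/2}, 1) such that for every directed edge a of G, |M'_{r,a}(f) − (1/|E|) Σ_{e∈E} f(e)| ≤ C ‖f‖₂ β^r for all r, where M'_{r,a}(f) is the average of the lift of f over the edge arc of radius r based at a in the universal covering tree. -/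
open scoped Classical

/-- Distance from a vertex `v` to an (unordered) pair `e`: the minimum of the distances
to its two endpoints. -/
noncomputable def edgeDist {V : Type*} (T : SimpleGraph V) (v : V) : Sym2 V → ℕ :=
  Sym2.lift ⟨fun x y => min (T.dist v x) (T.dist v y), fun _ _ => min_comm _ _⟩

/-- The edge arc `A'_r(a)` based at the directed edge `a = (w', w)`:
`A'_0(a) = {a}`, and `A'_{r+1}(a) = S'_{r+1}(w') ∩ S'_r(w)` where
`S'_r(v)` is the edge sphere `{e ∈ E(T) | edgeDist v e = r}`. -/
noncomputable def edgeArc {V : Type*} (T : SimpleGraph V) (w' w : V) :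
    ℕ → Set (Sym2 V)
  | 0 => {s(w', w)}
  | (r + 1) => {e | e ∈ T.edgeSet ∧ edgeDist T w' e = r + 1 ∧ edgeDist T w e = r}

/-- In a tree, among the neighbours of `w` at most one is closer to a given vertex `y`. -/
theorem SimpleGraph.IsTree.eq_of_dist_add_one_eq {V : Type*} {T : SimpleGraph V} (hT : T.IsTree)
    {w z z' y : V} (hz : T.Adj w z) (hz' : T.Adj w z') (h : T.dist z y + 1 = T.dist w y)
    (h' : T.dist z' y + 1 = T.dist w y) : z = z' := by
  obtain ⟨p, hp⟩ := hT.connected.exists_walk_length_eq_dist z y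
  obtain ⟨p', hp'⟩ := hT.connected.exists_walk_length_eq_dist z' y
  have hP : (SimpleGraph.Walk.cons hz p).IsPath :=
    SimpleGraph.Walk.isPath_of_length_eq_dist _ (by simp [hp, h])
  have hP' : (SimpleGraph.Walk.cons hz' p').IsPath :=
    SimpleGraph.Walk.isPath_of_length_eq_dist _ (by simp [hp', h'])
  have := hT.isAcyclic.subsingleton_path w y
  have heq := congrArg Subtype.val (Subsingleton.elim (⟨_, hP⟩ : T.Path w y) ⟨_, hP'⟩)
  have := congrArg (fun q : T.Walk w y => q.snd) heq
  simpa using this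

/-- If `y` is at nonzero distance from `w`, some neighbour of `w` is closer to `y`. -/
theorem SimpleGraph.Connected.exists_adj_dist_add_one_eq {V : Type*} {T : SimpleGraph V}
    (hT : T.Connected) {w y : V} (h : T.dist w y ≠ 0) :
    ∃ z, T.Adj w z ∧ T.dist z y + 1 = T.dist w y := by
  obtain ⟨p, hp⟩ := hT.exists_walk_length_eq_dist w y
  cases p with
  | nil => simp at h
  | @cons _ z _ hz p =>
    refine ⟨z, hz, ?_⟩
    have h1 := SimpleGraph.dist_le p
    have h2 := hz.diff_dist_adj (u := y)
    rw [SimpleGraph.dist_comm (u := y), SimpleGraph.dist_comm (u := y)] at h2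
    simp only [SimpleGraph.Walk.length_cons] at hp
    omega

theorem SimpleGraph.IsTree.dist_eq_dist_add_one_of_adj_left {V : Type*} {T : SimpleGraph V}
    (hT : T.IsTree) {v w : V} (h : T.Adj v w) (u : V) :
    T.dist v u = T.dist w u + 1 ∨ T.dist w u = T.dist v u + 1 := by
  simpa only [T.dist_comm] using hT.dist_eq_dist_add_one_of_adj u h

theorem edgeArc_succ {V : Type*} {T : SimpleGraph V} (hT : T.IsTree) {w' w : V}
    (h : T.Adj w' w) (r : ℕ) :
    edgeArc T w' w (r + 1) = ⋃ z ∈ T.neighborSet w \ {w'}, edgeArc T w z r := by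
  ext e
  induction e using Sym2.ind with | _ x y
  simp only [Set.mem_iUnion, Set.mem_sdiff, SimpleGraph.mem_neighborSet, Set.mem_singleton_iff,
    exists_prop]
  have hd0 : ∀ {u v : V}, T.dist u v = 0 ↔ u = v := hT.connected.dist_eq_zero_iff
  cases r with
  | zero =>
    simp only [edgeArc, edgeDist, Set.mem_ofPred_eq, SimpleGraph.mem_edgeSet, Sym2.lift_mk,
      Set.mem_singleton_iff, Sym2.eq_iff, zero_add]
    constructor
    · rintro ⟨hxy, h1, h2⟩
      rcases (by omega : T.dist w x = 0 ∨ T.dist w y = 0) with h3 | h3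
      · obtain rfl := hd0.1 h3
        refine ⟨y, ⟨hxy, ?_⟩, .inl ⟨rfl, rfl⟩⟩
        rintro rfl
        simp at h1
      · obtain rfl := hd0.1 h3
        refine ⟨x, ⟨hxy.symm, ?_⟩, .inr ⟨rfl, rfl⟩⟩
        rintro rfl
        simp at h1
    · rintro ⟨z, ⟨hz, hne⟩, ⟨rfl, rfl⟩ | ⟨rfl, rfl⟩⟩
      · have : T.dist w' x = 1 := SimpleGraph.dist_eq_one_iff_adj.2 h
        have : T.dist w' y ≠ 0 := fun h0 => hne (hd0.1 h0).symm
        refine ⟨hz, by omega, by simp⟩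
      · have : T.dist w' y = 1 := SimpleGraph.dist_eq_one_iff_adj.2 h
        have : T.dist w' x ≠ 0 := fun h0 => hne (hd0.1 h0).symm
        refine ⟨hz.symm, by omega, by simp⟩
  | succ r =>
    simp only [edgeArc, edgeDist, Set.mem_ofPred_eq, SimpleGraph.mem_edgeSet, Sym2.lift_mk]
    have a1 := hT.dist_eq_dist_add_one_of_adj_left h x
    have a2 := hT.dist_eq_dist_add_one_of_adj_left h y
    constructor
    · rintro ⟨hxy, h1, h2⟩
      have a3 := hT.dist_eq_dist_add_one_of_adj w hxy
      have key : ∀ u, T.dist w u = r + 1 → T.dist w' u = r + 2 →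
          ∃ z, (T.Adj w z ∧ z ≠ w') ∧ T.dist z u + 1 = T.dist w u := by
        intro u hu hu'
        obtain ⟨z, hz, hzu⟩ := hT.connected.exists_adj_dist_add_one_eq (by omega : T.dist w u ≠ 0)
        refine ⟨z, ⟨hz, ?_⟩, hzu⟩
        rintro rfl
        omega
      rcases (by omega : T.dist w x = r + 1 ∨ T.dist w y = r + 1) with h3 | h3
      · obtain ⟨z, hz, hzu⟩ := key x h3 (by omega)
        have a4 := hT.dist_eq_dist_add_one_of_adj_left hz.1 y
        exact ⟨z, hz, hxy, by omega, by omega⟩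
      · obtain ⟨z, hz, hzu⟩ := key y h3 (by omega)
        have a4 := hT.dist_eq_dist_add_one_of_adj_left hz.1 x
        exact ⟨z, hz, hxy, by omega, by omega⟩
    · rintro ⟨z, ⟨hz, hne⟩, hxy, h1, h2⟩
      have a3 := hT.dist_eq_dist_add_one_of_adj w hxy
      have a3' := hT.dist_eq_dist_add_one_of_adj z hxy
      have a4 := hT.dist_eq_dist_add_one_of_adj_left hz x
      have a5 := hT.dist_eq_dist_add_one_of_adj_left hz y
      have key : ∀ u, ¬ (T.dist z u + 1 = T.dist w u) ∨ ¬ (T.dist w' u + 1 = T.dist w u) :=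
        fun u => not_and_or.1 fun hu => hne (hT.eq_of_dist_add_one_eq hz h.symm hu.1 hu.2)
      have k1 := key x
      have k2 := key y
      refine ⟨hxy, ?_, by omega⟩
      rcases (by omega : T.dist z x = r ∨ T.dist z y = r) with h3 | h3 <;> omega

theorem pairwiseDisjoint_edgeArc {V : Type*} {T : SimpleGraph V} (hT : T.IsTree) (w : V)
    (r : ℕ) : (T.neighborSet w).PairwiseDisjoint fun z => edgeArc T w z r := by
  intro z hz z' hz' hne
  rw [Function.onFun, Set.disjoint_left]
  intro e he he'
  apply hne
  cases r with
  | zero =>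
    simp only [edgeArc, Set.mem_singleton_iff] at he he'
    exact Sym2.congr_right.1 (he.symm.trans he')
  | succ r =>
    induction e using Sym2.ind with | _ x y
    simp only [edgeArc, edgeDist, Set.mem_ofPred_eq, SimpleGraph.mem_edgeSet, Sym2.lift_mk]
      at he he'
    have a1 := hT.dist_eq_dist_add_one_of_adj w he.1
    have b1 := hT.dist_eq_dist_add_one_of_adj_left hz x
    have b2 := hT.dist_eq_dist_add_one_of_adj_left hz y
    have c1 := hT.dist_eq_dist_add_one_of_adj_left hz' x
    have c2 := hT.dist_eq_dist_add_one_of_adj_left hz' y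
    rcases (by omega : T.dist w x = r + 1 ∨ T.dist w y = r + 1) with h3 | h3
    · exact hT.eq_of_dist_add_one_eq hz hz' (y := x) (by omega) (by omega)
    · exact hT.eq_of_dist_add_one_eq hz hz' (y := y) (by omega) (by omega)

/-- The normalized non-backtracking operator: `g` is averaged over the directed edges
continuing `(x, y)` without turning back. -/
noncomputable def nbAverage {V : Type*} [Fintype V] (G : SimpleGraph V) (q : ℕ)
    (g : V → V → ℝ) : V → V → ℝ :=
  fun x y => if G.Adj x y then (∑ z, g y z - g y x) / q else 0

theorem nbAverage_of_not_adj {V : Type*} [Fintype V] {G : SimpleGraph V} {q : ℕ}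
    {g : V → V → ℝ} {x y : V} (h : ¬ G.Adj x y) : nbAverage G q g x y = 0 := if_neg h

theorem nbAverage_iterate_of_not_adj {V : Type*} [Fintype V] {G : SimpleGraph V} {q : ℕ}
    {g : V → V → ℝ} (hg : ∀ x y, ¬ G.Adj x y → g x y = 0) (r : ℕ) {x y : V}
    (h : ¬ G.Adj x y) : (nbAverage G q)^[r] g x y = 0 := by
  cases r with
  | zero => exact hg x y h
  | succ r => rw [Function.iterate_succ_apply']; exact nbAverage_of_not_adj h

/-- A function on edges, seen as a function on directed edges. -/
noncomputable def dartLift {V : Type*} (G : SimpleGraph V) (f : Sym2 V → ℝ) : V → V → ℝ :=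
  fun x y => if G.Adj x y then f s(x, y) else 0

theorem finsum_edgeArc_eq {q : ℕ} (hq : q ≠ 0) {VG VT : Type*} [Fintype VG]
    {G : SimpleGraph VG} {T : SimpleGraph VT} (hT : T.IsTree) (π : T →g G)
    (hcov : ∀ v : VT, Set.BijOn π (T.neighborSet v) (G.neighborSet (π v)))
    (f : Sym2 VG → ℝ) (r : ℕ) {w' w : VT} (h : T.Adj w' w) :
    (edgeArc T w' w r).Finite ∧ ∑ᶠ e ∈ edgeArc T w' w r, f (Sym2.map π e) =
      (q : ℝ) ^ r * (nbAverage G q)^[r] (dartLift G f) (π w') (π w) := by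
  induction r generalizing w' w with
  | zero => simp [edgeArc, dartLift, π.map_adj h]
  | succ r ih =>
    have hfin : (T.neighborSet w \ {w'}).Finite :=
      ((hcov w).finite_iff_finite.2 (Set.toFinite _)).sdiff
    have hfin' : ∀ z ∈ T.neighborSet w \ {w'}, (edgeArc T w z r).Finite :=
      fun z hz => (ih hz.1).1
    rw [edgeArc_succ hT h]
    refine ⟨hfin.biUnion hfin', ?_⟩
    rw [finsum_mem_biUnion ((pairwiseDisjoint_edgeArc hT w r).subset Set.sdiff_subset) hfin hfin',
      finsum_mem_congr rfl fun z hz => (ih hz.1).2]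
    have hbij : Set.BijOn π (T.neighborSet w \ {w'}) (G.neighborSet (π w) \ {π w'}) := by
      have := (hcov w).sdiff_singleton (show w' ∈ T.neighborSet w from h.symm)
      exact this
    set g := (nbAverage G q)^[r] (dartLift G f) with hg
    have hsupp : ∀ x y, ¬ G.Adj x y → g x y = 0 := fun x y hxy =>
      nbAverage_iterate_of_not_adj (fun x y hxy => if_neg hxy) r hxy
    rw [finsum_mem_eq_of_bijOn (g := fun z => (q : ℝ) ^ r * g (π w) z) π hbij fun _ _ => rfl,
      Function.iterate_succ_apply', ← hg, nbAverage, if_pos (π.map_adj h),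
      finsum_mem_eq_finite_toFinset_sum _ (Set.toFinite _), ← Finset.mul_sum, pow_succ, mul_assoc,
      mul_div_cancel₀ _ (Nat.cast_ne_zero.2 hq), ← Finset.sum_erase_eq_sub (Finset.mem_univ _)]
    congr 1
    refine Finset.sum_subset (fun z => by simp) fun z hz hz' => hsupp _ _ ?_
    simp only [Finset.mem_erase, Finset.mem_univ, and_true] at hz
    simpa [hz] using hz'

theorem SimpleGraph.IsRegularOfDegree.sum_ite_adj {V : Type*} [Fintype V] {G : SimpleGraph V}
    {d : ℕ} (hG : G.IsRegularOfDegree d) (x : V) (c : ℝ) :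
    ∑ y, (if G.Adj x y then c else 0) = d * c := by
  rw [← Finset.sum_filter, Finset.sum_const, nsmul_eq_mul, ← hG x,
    ← G.card_neighborFinset_eq_degree]
  congr 3
  ext y
  simp

/-- Squared `ℓ²` norm of a function of two variables. -/
noncomputable def sumSq {V : Type*} [Fintype V] (g : V → V → ℝ) : ℝ := ∑ x, ∑ y, g x y ^ 2

theorem sumSq_nonneg {V : Type*} [Fintype V] (g : V → V → ℝ) : 0 ≤ sumSq g :=
  Finset.sum_nonneg fun _ _ => Finset.sum_nonneg fun _ _ => sq_nonneg _

theorem sq_le_sumSq {V : Type*} [Fintype V] (g : V → V → ℝ) (x y : V) : g x y ^ 2 ≤ sumSq g :=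
  (Finset.single_le_sum (f := fun y => g x y ^ 2) (fun _ _ => sq_nonneg _)
    (Finset.mem_univ y)).trans
  (Finset.single_le_sum (f := fun x => ∑ y, g x y ^ 2)
    (fun _ _ => Finset.sum_nonneg fun _ _ => sq_nonneg _) (Finset.mem_univ x))

/-- The functions `h` on vertices which are constant on each neighbourhood. -/
def ConstOnNeighbors {V : Type*} (G : SimpleGraph V) (h : V → ℝ) : Prop :=
  ∀ ⦃x y y'⦄, G.Adj x y → G.Adj x y' → h y = h y'

/-- The functions on directed edges orthogonal to all `(x, y) ↦ h x` with `h` constant on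
neighbourhoods, i.e. to the eigenfunctions of `nbAverage` of modulus one. -/
structure IsBalanced {V : Type*} [Fintype V] (G : SimpleGraph V) (g : V → V → ℝ) : Prop where
  eq_zero : ∀ x y, ¬ G.Adj x y → g x y = 0
  sum_mul_eq_zero : ∀ h, ConstOnNeighbors G h → ∑ x, ∑ y, g x y * h x = 0

section Spectral

variable {V : Type*} [Fintype V] {G : SimpleGraph V} {q : ℕ}

/-- The mean over the neighbours. -/
noncomputable def neighborMean (G : SimpleGraph V) (q : ℕ) (h : V → ℝ) (x : V) : ℝ :=
  (∑ y, if G.Adj x y then h y else 0) / (q + 1)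

theorem ConstOnNeighbors.eq_neighborMean (hG : G.IsRegularOfDegree (q + 1)) {h : V → ℝ}
    (hh : ConstOnNeighbors G h) {x y : V} (hxy : G.Adj x y) : h y = neighborMean G q h x := by
  have : ∀ z, (if G.Adj x z then h z else 0) = if G.Adj x z then h y else 0 := fun z => by
    split_ifs with hz
    · exact hh hz hxy
    · rfl
  rw [neighborMean, Finset.sum_congr rfl fun z _ => this z, hG.sum_ite_adj]
  push_cast
  field_simp

theorem ConstOnNeighbors.neighborMean (hG : G.IsRegularOfDegree (q + 1)) {h : V → ℝ}
    (hh : ConstOnNeighbors G h) : ConstOnNeighbors G (neighborMean G q h) := fun _ _ _ hy hy' => by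
  rw [← hh.eq_neighborMean hG hy.symm, ← hh.eq_neighborMean hG hy'.symm]

theorem IsBalanced.nbAverage (hq : q ≠ 0) (hG : G.IsRegularOfDegree (q + 1)) {g : V → V → ℝ}
    (hg : IsBalanced G g) : IsBalanced G (nbAverage G q g) where
  eq_zero _ _ := nbAverage_of_not_adj
  sum_mul_eq_zero h hh := by
    rw [Finset.sum_comm, ← hg.sum_mul_eq_zero _ (hh.neighborMean hG)]
    refine Finset.sum_congr rfl fun y _ => ?_
    have hq' : (q : ℝ) ≠ 0 := Nat.cast_ne_zero.2 hq
    have key : ∀ x, _root_.nbAverage G q g x y * h x =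
        ((if G.Adj y x then (∑ z, g y z) * neighborMean G q h y else 0) -
          g y x * neighborMean G q h y) / q := fun x => by
      by_cases hxy : G.Adj x y
      · rw [_root_.nbAverage, if_pos hxy, if_pos hxy.symm, hh.eq_neighborMean hG hxy.symm]
        ring
      · rw [nbAverage_of_not_adj hxy, if_neg fun h' => hxy h'.symm,
          hg.eq_zero y x fun h' => hxy h'.symm]
        simp
    rw [Finset.sum_congr rfl fun x _ => key x, ← Finset.sum_div, Finset.sum_sub_distrib,
      hG.sum_ite_adj, ← Finset.sum_mul]
    push_cast
    field_simp
    ring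

/-- The loss of `ℓ²` norm under `nbAverage` is the variance over the directed edges leaving
each vertex. -/
theorem sumSq_nbAverage (hq : q ≠ 0) (hG : G.IsRegularOfDegree (q + 1)) {g : V → V → ℝ}
    (hg : ∀ x y, ¬ G.Adj x y → g x y = 0) :
    (q : ℝ) ^ 2 * sumSq (nbAverage G q g) = (q : ℝ) ^ 2 * sumSq g - ((q : ℝ) ^ 2 - 1) *
      ∑ x, ∑ y, if G.Adj x y then (g x y - (∑ z, g x z) / (q + 1)) ^ 2 else 0 := by
  have hq' : (q : ℝ) ≠ 0 := Nat.cast_ne_zero.2 hq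
  rw [sumSq, sumSq, Finset.sum_comm, Finset.mul_sum, Finset.mul_sum, Finset.mul_sum,
    ← Finset.sum_sub_distrib]
  refine Finset.sum_congr rfl fun y _ => ?_
  set S := ∑ z, g y z with hS
  have e1 : ∀ x, nbAverage G q g x y ^ 2 =
      ((if G.Adj y x then S ^ 2 else 0) - 2 * S * g y x + g y x ^ 2) / (q : ℝ) ^ 2 := fun x => by
    by_cases hxy : G.Adj x y
    · rw [nbAverage, if_pos hxy, if_pos hxy.symm, ← hS]
      ring
    · rw [nbAverage_of_not_adj hxy, if_neg fun h' => hxy h'.symm, hg y x fun h' => hxy h'.symm]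
      simp
  have e2 : ∀ x, (if G.Adj y x then (g y x - S / (q + 1)) ^ 2 else 0) =
      g y x ^ 2 - 2 * (S / (q + 1)) * g y x + (if G.Adj y x then (S / (q + 1)) ^ 2 else 0) :=
    fun x => by
      by_cases hxy : G.Adj y x
      · rw [if_pos hxy, if_pos hxy]
        ring
      · rw [if_neg hxy, if_neg hxy, hg y x hxy]
        simp
  rw [Finset.sum_congr rfl fun x _ => e1 x, Finset.sum_congr rfl fun x _ => e2 x,
    ← Finset.sum_div, Finset.sum_add_distrib, Finset.sum_sub_distrib, Finset.sum_add_distrib,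
    Finset.sum_sub_distrib, hG.sum_ite_adj, hG.sum_ite_adj, ← Finset.mul_sum, ← Finset.mul_sum,
    ← hS]
  push_cast
  field_simp
  ring

theorem sumSq_nbAverage_le (hq : 2 ≤ q) (hG : G.IsRegularOfDegree (q + 1)) {g : V → V → ℝ}
    (hg : ∀ x y, ¬ G.Adj x y → g x y = 0) : sumSq (nbAverage G q g) ≤ sumSq g := by
  have hq2 : (2 : ℝ) ≤ q := by exact_mod_cast hq
  have hvar : 0 ≤ ∑ x, ∑ y, if G.Adj x y then (g x y - (∑ z, g x z) / (q + 1)) ^ 2 else 0 :=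
    Finset.sum_nonneg fun _ _ => Finset.sum_nonneg fun _ _ => by positivity
  have := mul_nonneg (by nlinarith : (0 : ℝ) ≤ (q : ℝ) ^ 2 - 1) hvar
  have h := sumSq_nbAverage (by omega) hG hg
  exact le_of_mul_le_mul_left (by linarith) (by positivity : (0 : ℝ) < (q : ℝ) ^ 2)

theorem eq_mean_of_sumSq_nbAverage_eq (hq : 2 ≤ q) (hG : G.IsRegularOfDegree (q + 1))
    {g : V → V → ℝ} (hg : ∀ x y, ¬ G.Adj x y → g x y = 0)
    (h : sumSq (nbAverage G q g) = sumSq g) {x y : V} (hxy : G.Adj x y) :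
    g x y = (∑ z, g x z) / (q + 1) := by
  have hq2 : (2 : ℝ) ≤ q := by exact_mod_cast hq
  have h1 := sumSq_nbAverage (by omega) hG hg
  have hpos : ∀ x y, 0 ≤ if G.Adj x y then (g x y - (∑ z, g x z) / (q + 1)) ^ 2 else 0 :=
    fun _ _ => by positivity
  have h2 : ∑ x, ∑ y, (if G.Adj x y then (g x y - (∑ z, g x z) / (q + 1)) ^ 2 else 0) = 0 :=
    (mul_eq_zero.1 (by rw [h] at h1; linarith)).resolve_left
      (by nlinarith : (q : ℝ) ^ 2 - 1 ≠ 0)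
  rw [Fintype.sum_eq_zero_iff_of_nonneg fun x => Finset.sum_nonneg fun y _ => hpos x y] at h2
  have h3 := congrFun h2 x
  rw [Pi.zero_apply, Fintype.sum_eq_zero_iff_of_nonneg (hpos x)] at h3
  have h4 := congrFun h3 y
  simp only [hxy, if_true, Pi.zero_apply] at h4
  linarith [pow_eq_zero_iff (two_ne_zero) |>.1 h4]

theorem IsBalanced.eq_zero_of_sumSq_eq (hq : 2 ≤ q) (hG : G.IsRegularOfDegree (q + 1))
    {g : V → V → ℝ} (hg : IsBalanced G g)
    (h : sumSq (_root_.nbAverage G q (_root_.nbAverage G q g)) = sumSq g) : g = 0 := by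
  have hg' := hg.nbAverage (by omega) hG
  have hle := sumSq_nbAverage_le hq hG hg.eq_zero
  have hle' := sumSq_nbAverage_le hq hG hg'.eq_zero
  set m : V → ℝ := fun x => (∑ z, g x z) / (q + 1) with hm
  have h1 : ∀ x y, G.Adj x y → g x y = m x := fun x y hxy =>
    eq_mean_of_sumSq_nbAverage_eq hq hG hg.eq_zero (by linarith) hxy
  have h2 : ∀ x y, G.Adj x y → _root_.nbAverage G q g x y = m y := fun x y hxy => by
    have hq' : (q : ℝ) ≠ 0 := Nat.cast_ne_zero.2 (by omega)
    rw [_root_.nbAverage, if_pos hxy, h1 y x hxy.symm]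
    simp only [hm]
    field_simp
    ring
  have hconst : ConstOnNeighbors G m := fun x y y' hy hy' => by
    rw [← h2 x y hy, ← h2 x y' hy',
      eq_mean_of_sumSq_nbAverage_eq hq hG hg'.eq_zero (by linarith) hy,
      eq_mean_of_sumSq_nbAverage_eq hq hG hg'.eq_zero (by linarith) hy']
  have h3 := hg.sum_mul_eq_zero m hconst
  have h4 : ∀ x, ∑ y, g x y * m x = (q + 1) * m x ^ 2 := fun x => by
    rw [← Finset.sum_mul]
    simp only [hm]
    field_simp
  rw [Finset.sum_congr rfl fun x _ => h4 x,
    Fintype.sum_eq_zero_iff_of_nonneg fun x => by dsimp; positivity] at h3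
  ext x y
  by_cases hxy : G.Adj x y
  · rw [h1 x y hxy]
    have := congrFun h3 x
    simpa [show (q : ℝ) + 1 ≠ 0 by positivity] using this
  · exact hg.eq_zero x y hxy

theorem nbAverage_smul (c : ℝ) (g : V → V → ℝ) :
    nbAverage G q (c • g) = c • nbAverage G q g := by
  ext x y
  simp only [nbAverage, Pi.smul_apply, smul_eq_mul, mul_ite, mul_zero, ← Finset.mul_sum]
  congr 1
  ring

theorem sumSq_smul (c : ℝ) (g : V → V → ℝ) : sumSq (c • g) = c ^ 2 * sumSq g := by
  simp [sumSq, mul_pow, Finset.mul_sum]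

theorem IsBalanced.smul {g : V → V → ℝ} (hg : IsBalanced G g) (c : ℝ) :
    IsBalanced G (c • g) where
  eq_zero x y hxy := by simp [hg.eq_zero x y hxy]
  sum_mul_eq_zero h hh := by
    simp [mul_assoc, ← Finset.mul_sum, hg.sum_mul_eq_zero h hh]

theorem continuous_nbAverage : Continuous (nbAverage G q) := by
  refine continuous_pi fun x => continuous_pi fun y => ?_
  unfold nbAverage
  split_ifs <;> fun_prop

theorem continuous_sumSq : Continuous (sumSq : (V → V → ℝ) → ℝ) := by
  unfold sumSq
  fun_prop

theorem isCompact_isBalanced_sumSq_eq_one :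
    IsCompact {g : V → V → ℝ | IsBalanced G g ∧ sumSq g = 1} := by
  refine Metric.isCompact_of_isClosed_isBounded ?_ ?_
  · have : {g : V → V → ℝ | IsBalanced G g ∧ sumSq g = 1} =
        ((⋂ x, ⋂ y, ⋂ (_ : ¬ G.Adj x y), {g | g x y = 0}) ∩
          ⋂ h, ⋂ (_ : ConstOnNeighbors G h), {g | ∑ x, ∑ y, g x y * h x = 0}) ∩
            {g | sumSq g = 1} := by
      ext g
      simp only [Set.mem_inter_iff, Set.mem_iInter, Set.mem_ofPred_eq]
      exact and_congr_left fun _ => ⟨fun h => ⟨h.1, h.2⟩, fun h => ⟨h.1, h.2⟩⟩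
    rw [this]
    refine ((isClosed_iInter fun x => isClosed_iInter fun y => isClosed_iInter fun _ =>
      isClosed_eq (by fun_prop) continuous_const).inter
      (isClosed_iInter fun h => isClosed_iInter fun _ =>
        isClosed_eq (by fun_prop) continuous_const)).inter
      (isClosed_eq continuous_sumSq continuous_const)
  · refine (Metric.isBounded_closedBall (x := (0 : V → V → ℝ)) (r := 1)).subset fun g hg => ?_
    rw [mem_closedBall_zero_iff, pi_norm_le_iff_of_nonneg zero_le_one]
    intro x
    rw [pi_norm_le_iff_of_nonneg zero_le_one]
    intro y
    rw [Real.norm_eq_abs, ← sq_le_one_iff_abs_le_one]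
    exact (sq_le_sumSq g x y).trans hg.2.le

/-- Two steps of `nbAverage` contract the balanced functions strictly. -/
theorem exists_sumSq_nbAverage_nbAverage_le (hq : 2 ≤ q) (hG : G.IsRegularOfDegree (q + 1)) :
    ∃ ρ : ℝ, 0 ≤ ρ ∧ ρ < 1 ∧ ∀ g : V → V → ℝ, IsBalanced G g →
      sumSq (nbAverage G q (nbAverage G q g)) ≤ ρ * sumSq g := by
  have hzero : ∀ g : V → V → ℝ, sumSq g = 0 → g = 0 := fun g hg => by
    ext x y
    have := sq_le_sumSq g x y
    rw [hg] at this
    simpa using le_antisymm this (sq_nonneg _)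
  rcases {g : V → V → ℝ | IsBalanced G g ∧ sumSq g = 1}.eq_empty_or_nonempty with hK | hK
  · refine ⟨0, le_rfl, one_pos, fun g hg => ?_⟩
    by_cases h0 : sumSq g = 0
    · obtain rfl := hzero g h0
      have := sumSq_nbAverage_le hq hG hg.eq_zero
      have := sumSq_nbAverage_le hq hG (hg.nbAverage (by omega) hG).eq_zero
      linarith
    · exfalso
      have hmem : (√(sumSq g))⁻¹ • g ∈ {g : V → V → ℝ | IsBalanced G g ∧ sumSq g = 1} :=
        ⟨hg.smul _, by
          rw [sumSq_smul, inv_pow, Real.sq_sqrt (sumSq_nonneg g), inv_mul_cancel₀ h0]⟩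
      rw [hK] at hmem
      exact hmem
  · obtain ⟨g₀, hg₀, hmax⟩ := isCompact_isBalanced_sumSq_eq_one.exists_isMaxOn hK
      (continuous_sumSq.comp (continuous_nbAverage.comp
        (continuous_nbAverage (G := G) (q := q)))).continuousOn
    refine ⟨sumSq (nbAverage G q (nbAverage G q g₀)), sumSq_nonneg _, ?_, fun g hg => ?_⟩
    · have h1 := sumSq_nbAverage_le hq hG hg₀.1.eq_zero
      have h2 := sumSq_nbAverage_le hq hG (hg₀.1.nbAverage (by omega) hG).eq_zero
      refine lt_of_le_of_ne (by linarith [hg₀.2]) fun h => ?_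
      have h3 := hg₀.1.eq_zero_of_sumSq_eq hq hG (h.trans hg₀.2.symm)
      have h4 := hg₀.2
      simp [h3, sumSq] at h4
    · by_cases h0 : sumSq g = 0
      · have := sumSq_nbAverage_le hq hG hg.eq_zero
        have := sumSq_nbAverage_le hq hG (hg.nbAverage (by omega) hG).eq_zero
        rw [h0, mul_zero]
        linarith
      · have hpos : 0 < sumSq g := (sumSq_nonneg g).lt_of_ne' h0
        have h1 := hmax (show (√(sumSq g))⁻¹ • g ∈ _ from ⟨hg.smul _, by
          rw [sumSq_smul, inv_pow, Real.sq_sqrt (sumSq_nonneg g), inv_mul_cancel₀ h0]⟩)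
        simp only [Set.mem_ofPred_eq, Function.comp_apply, nbAverage_smul, sumSq_smul, inv_pow,
          Real.sq_sqrt (sumSq_nonneg g)] at h1
        rwa [inv_mul_le_iff₀ hpos, mul_comm] at h1

theorem sumSq_nbAverage_iterate_le (hq : 2 ≤ q) (hG : G.IsRegularOfDegree (q + 1)) {β : ℝ}
    (hβ₀ : 0 ≤ β) (hβ₁ : β ≤ 1)
    (hβ : ∀ g : V → V → ℝ, IsBalanced G g →
      sumSq (nbAverage G q (nbAverage G q g)) ≤ β ^ 4 * sumSq g)
    (r : ℕ) {g : V → V → ℝ} (hg : IsBalanced G g) :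
    β ^ 2 * sumSq ((nbAverage G q)^[r] g) ≤ β ^ (2 * r) * sumSq g := by
  induction r using Nat.twoStepInduction generalizing g with
  | zero => simpa using mul_le_of_le_one_left (sumSq_nonneg g) (pow_le_one₀ hβ₀ hβ₁)
  | one => exact mul_le_mul_of_nonneg_left (sumSq_nbAverage_le hq hG hg.eq_zero) (by positivity)
  | more r ih _ =>
    calc β ^ 2 * sumSq ((nbAverage G q)^[r + 2] g)
        ≤ β ^ (2 * r) * sumSq (nbAverage G q (nbAverage G q g)) :=
          ih ((hg.nbAverage (by omega) hG).nbAverage (by omega) hG)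
      _ ≤ β ^ (2 * r) * (β ^ 4 * sumSq g) := by gcongr; exact hβ g hg
      _ = β ^ (2 * (r + 2)) * sumSq g := by ring

theorem sum_dartLift (G : SimpleGraph V) (f : Sym2 V → ℝ) :
    ∑ x, ∑ y, dartLift G f x y = 2 * ∑ e ∈ G.edgeFinset, f e := by
  have h1 : ∑ x, ∑ y, dartLift G f x y = ∑ d : G.Dart, f d.edge := by
    rw [← Fintype.sum_prod_type' (f := fun x y => dartLift G f x y)]
    simp only [dartLift]
    rw [← Finset.sum_filter]
    refine (Finset.sum_bij (fun d _ => d.toProd) ?_ ?_ ?_ ?_).symm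
    · intro d _
      simp
    · intro d _ d' _ h
      exact SimpleGraph.Dart.ext _ _ h
    · intro p hp
      exact ⟨⟨p, by simpa using hp⟩, Finset.mem_univ _, rfl⟩
    · intro d _
      rfl
  rw [h1, ← Finset.sum_fiberwise_of_maps_to (s := Finset.univ) (t := G.edgeFinset)
    (g := fun d : G.Dart => d.edge) (fun d _ => by
      rw [SimpleGraph.mem_edgeFinset]; exact d.edge_mem), Finset.mul_sum]
  refine Finset.sum_congr rfl fun e he => ?_
  rw [Finset.sum_congr rfl (g := fun _ => f e) fun d hd => by rw [(Finset.mem_filter.1 hd).2],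
    Finset.sum_const, G.dart_edge_fiber_card e (SimpleGraph.mem_edgeFinset.1 he), two_nsmul,
    two_mul]

theorem sumSq_dartLift (G : SimpleGraph V) (f : Sym2 V → ℝ) :
    sumSq (dartLift G f) = 2 * ∑ e ∈ G.edgeFinset, f e ^ 2 := by
  rw [← sum_dartLift, sumSq]
  simp [dartLift]

/-- The lift of a function of mean zero on the edges of a connected graph is balanced. -/
theorem isBalanced_dartLift (hconn : G.Connected) (hG : G.IsRegularOfDegree (q + 1))
    {f : Sym2 V → ℝ} (hf : ∑ e ∈ G.edgeFinset, f e = 0) : IsBalanced G (dartLift G f) where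
  eq_zero _ _ hxy := if_neg hxy
  sum_mul_eq_zero h hh := by
    have hsymm : ∀ x y, dartLift G f x y = dartLift G f y x := fun x y => by
      simp only [dartLift, G.adj_comm, Sym2.eq_swap]
    obtain ⟨x₀⟩ := hconn.nonempty
    set s : V → ℝ := fun x => h x + neighborMean G q h x with hs
    have hadj : ∀ x y, G.Adj x y → s x = s y := fun x y hxy => by
      simp only [hs]
      rw [← hh.eq_neighborMean hG hxy, ← hh.eq_neighborMean hG hxy.symm, add_comm]
    have hconst : ∀ x, s x = s x₀ := fun x => by
      obtain ⟨p⟩ := hconn.preconnected x x₀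
      induction p with
      | nil => rfl
      | cons hxy _ ih => exact (hadj _ _ hxy).trans ih
    have hswap : ∑ x, ∑ y, dartLift G f x y * h x = ∑ x, ∑ y, dartLift G f x y * h y := by
      rw [Finset.sum_comm]
      exact Finset.sum_congr rfl fun x _ => Finset.sum_congr rfl fun y _ => by rw [hsymm]
    have hsum : ∑ x, ∑ y, dartLift G f x y * h x + ∑ x, ∑ y, dartLift G f x y * h y =
        ∑ x, ∑ y, dartLift G f x y * s x₀ := by
      simp only [← Finset.sum_add_distrib]
      refine Finset.sum_congr rfl fun x _ => Finset.sum_congr rfl fun y _ => ?_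
      by_cases hxy : G.Adj x y
      · rw [← hconst x, hs, ← mul_add, hh.eq_neighborMean hG hxy]
      · simp [dartLift, hxy]
    simp only [← Finset.sum_mul, sum_dartLift, hf] at hsum hswap ⊢
    linarith

end Spectral

theorem finsum_mem_const_eq_ncard_mul {α : Type*} {s : Set α} (hs : s.Finite) (c : ℝ) :
    ∑ᶠ _e ∈ s, c = s.ncard * c := by
  rw [finsum_mem_eq_finite_toFinset_sum _ hs, Finset.sum_const, nsmul_eq_mul,
    Set.ncard_eq_toFinset_card s hs]

theorem ncard_edgeArc {q : ℕ} (hq : q ≠ 0) {VG VT : Type*} [Fintype VG]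
    {G : SimpleGraph VG} (hG : G.IsRegularOfDegree (q + 1)) {T : SimpleGraph VT} (hT : T.IsTree)
    (π : T →g G) (hcov : ∀ v : VT, Set.BijOn π (T.neighborSet v) (G.neighborSet (π v)))
    (r : ℕ) {w' w : VT} (h : T.Adj w' w) : ((edgeArc T w' w r).ncard : ℝ) = (q : ℝ) ^ r := by
  have hfix : nbAverage G q (dartLift G fun _ => 1) = dartLift G fun _ => 1 := by
    ext x y
    by_cases hxy : G.Adj x y
    · have hq' : (q : ℝ) ≠ 0 := Nat.cast_ne_zero.2 hq
      simp only [nbAverage, dartLift]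
      rw [if_pos hxy, if_pos hxy, if_pos hxy.symm, hG.sum_ite_adj]
      push_cast
      field_simp
      ring
    · simp [nbAverage, dartLift, hxy]
  obtain ⟨hfin, hsum⟩ := finsum_edgeArc_eq hq hT π hcov (fun _ => 1) r h
  rw [finsum_mem_const_eq_ncard_mul hfin, Function.iterate_fixed hfix] at hsum
  simpa [dartLift, π.map_adj h] using hsum

/-- Theorem 2: for a finite connected simple `(q+1)`-regular graph `G` (edge degree
`2q ≥ 4`) with universal covering tree `T` (projection `π`) and `f` on its edges,
there are constants `C > 0` and `β ∈ {1/q} ∪ [q^{-1/2}, 1)` such that for every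
directed edge `a` of the tree and all `r`,
`|M'_{r,a}(f) - (1/|E|) ∑_e f(e)| ≤ C ‖f‖₂ βʳ`. -/
theorem stmt_13 (q : ℕ) (hq : 2 ≤ q) {VG VT : Type*} [Fintype VG]
    (G : SimpleGraph VG) (hGconn : G.Connected)
    (hGreg : G.IsRegularOfDegree (q + 1))
    (T : SimpleGraph VT) (hT : T.IsTree) (π : T →g G)
    (hcov : ∀ v : VT, Set.BijOn π (T.neighborSet v) (G.neighborSet (π v)))
    (f : Sym2 VG → ℝ) :
    ∃ C : ℝ, 0 < C ∧
      ∃ β ∈ insert ((q : ℝ)⁻¹) (Set.Ico ((Real.sqrt q)⁻¹) 1),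
        ∀ w' w : VT, T.Adj w' w → ∀ r : ℕ,
          |(∑ᶠ e ∈ edgeArc T w' w r, f (Sym2.map π e)) /
                ((edgeArc T w' w r).ncard : ℝ)
              - (∑ e ∈ G.edgeFinset, f e) / (G.edgeFinset.card : ℝ)|
            ≤ C * Real.sqrt (∑ e ∈ G.edgeFinset, f e ^ 2) * β ^ r := by
  have hq2 : (2 : ℝ) ≤ q := by exact_mod_cast hq
  have hq0 : q ≠ 0 := by omega
  obtain ⟨ρ, hρ₀, hρ₁, hρ⟩ := exists_sumSq_nbAverage_nbAverage_le hq hGreg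
  set β : ℝ := max (√(√ρ)) (√q)⁻¹
  have hβpos : 0 < β := lt_max_of_lt_right (by positivity)
  have hβ₁ : β < 1 := by
    refine max_lt ?_ (inv_lt_one_of_one_lt₀ (Real.lt_sqrt_of_sq_lt (by linarith)))
    rw [Real.sqrt_lt' one_pos, Real.sqrt_lt' (by norm_num)]
    simpa using hρ₁
  have hρβ : ρ ≤ β ^ 4 := calc
    ρ = √(√ρ) ^ 4 := by
      rw [show (4 : ℕ) = 2 * 2 from rfl, pow_mul, Real.sq_sqrt (Real.sqrt_nonneg _),
        Real.sq_sqrt hρ₀]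
    _ ≤ β ^ 4 := pow_le_pow_left₀ (Real.sqrt_nonneg _) (le_max_left _ _) 4
  refine ⟨√2 / β, by positivity, β, .inr ⟨le_max_right _ _, hβ₁⟩, fun w' w h r => ?_⟩
  set m : ℝ := (∑ e ∈ G.edgeFinset, f e) / (G.edgeFinset.card : ℝ)
  have hcard : (G.edgeFinset.card : ℝ) ≠ 0 := by
    refine Nat.cast_ne_zero.2 (Finset.card_ne_zero.2 ⟨s(π w', π w), ?_⟩)
    rw [SimpleGraph.mem_edgeFinset]
    exact π.map_adj h
  have hmcard : (G.edgeFinset.card : ℝ) * m = ∑ e ∈ G.edgeFinset, f e := mul_div_cancel₀ _ hcard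
  set f₀ : Sym2 VG → ℝ := fun e => f e - m with hf₀
  have hbal : IsBalanced G (dartLift G f₀) := by
    refine isBalanced_dartLift hGconn hGreg ?_
    rw [Finset.sum_sub_distrib, Finset.sum_const, nsmul_eq_mul, hmcard, sub_self]
  have hle : ∑ e ∈ G.edgeFinset, f₀ e ^ 2 ≤ ∑ e ∈ G.edgeFinset, f e ^ 2 := by
    have : ∑ e ∈ G.edgeFinset, f₀ e ^ 2 =
        ∑ e ∈ G.edgeFinset, f e ^ 2 - G.edgeFinset.card * m ^ 2 := by
      simp only [hf₀, sub_sq, Finset.sum_add_distrib, Finset.sum_sub_distrib, ← Finset.sum_mul,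
        ← Finset.mul_sum, ← hmcard, Finset.sum_const, nsmul_eq_mul]
      ring
    rw [this]
    exact sub_le_self _ (by positivity)
  obtain ⟨hfin, hsum⟩ := finsum_edgeArc_eq hq0 hT π hcov f₀ r h
  have hn := ncard_edgeArc hq0 hGreg hT π hcov r h
  have hsub : ∑ᶠ e ∈ edgeArc T w' w r, f₀ (Sym2.map π e) =
      ∑ᶠ e ∈ edgeArc T w' w r, f (Sym2.map π e) - (q : ℝ) ^ r * m := by
    rw [← hn, ← finsum_mem_const_eq_ncard_mul hfin, ← finsum_mem_sub_distrib _ _ hfin]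
  have hqr : (q : ℝ) ^ r ≠ 0 := pow_ne_zero _ (Nat.cast_ne_zero.2 hq0)
  rw [hn, div_sub' hqr, ← hsub, hsum, mul_div_cancel_left₀ _ hqr]
  have hit := sumSq_nbAverage_iterate_le hq hGreg hβpos.le hβ₁.le
    (fun g hg => (hρ g hg).trans (mul_le_mul_of_nonneg_right hρβ (sumSq_nonneg g))) r hbal
  rw [sumSq_dartLift] at hit
  have hval := sq_le_sumSq ((nbAverage G q)^[r] (dartLift G f₀)) (π w') (π w)
  have hS : 0 ≤ ∑ e ∈ G.edgeFinset, f e ^ 2 := Finset.sum_nonneg fun _ _ => sq_nonneg _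
  refine abs_le_of_sq_le_sq ?_ (by positivity)
  rw [mul_pow, mul_pow, div_pow, Real.sq_sqrt hS, Real.sq_sqrt zero_le_two, ← pow_mul,
    mul_comm r 2, div_mul_eq_mul_div, div_mul_eq_mul_div, le_div_iff₀ (by positivity)]
  calc _ ≤ β ^ 2 * sumSq ((nbAverage G q)^[r] (dartLift G f₀)) := by
        rw [mul_comm]; gcongr
    _ ≤ β ^ (2 * r) * (2 * ∑ e ∈ G.edgeFinset, f₀ e ^ 2) := hit
    _ ≤ β ^ (2 * r) * (2 * ∑ e ∈ G.edgeFinset, f e ^ 2) := by gcongr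
    _ = _ := by ring
end
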